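/- Fix T > 0 and λ > 0. Let (T_i)_{i≥1} be the arrival times of a homogeneous Poisson process of rate λ on [0,T] with N = N(T) = #{i : T_i ≤ T}. Let (ω_i)_{i≥1} be i.i.d. real random variables, distributed as ω, independent of the Poisson process and of (X_i), satisfying the Cramér condition E[exp(p·ω₋·T)] < ∞ for some p > α, where ω₋ = max(−ω,0). Let (X_i)_{i≥1} be identically distributed nonnegative random variables, independent of everything else, such that X₁ is regularly varying with index α > 0 and the family is uniformly asymptotically independent. Define the KDEM shot noise Y(T) = ∑_{i=1}^N X_i · exp(−ω_i (T − T_i)). Then lim_{x→∞} P(Y(T) > x) / P(X₁ > x) = λ · E[ (1 − e^{−αωT}) / (αω) ], where (1 − e^{−αωT})/(αω) is interpreted as T when ω = 0. -/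

import Mathlib

open MeasureTheory ProbabilityTheory Filter

theorem exists_forall_div_le_rpow_mul {F : ℝ → ℝ} (hanti : Antitone F) (hle : ∀ x, F x ≤ 1)
    (hpos : ∀ x, 0 < x → 0 < F x) {α p : ℝ} (hp : α < p) (hp0 : 0 < p)
    (hRV : Tendsto (fun x => F (2 * x) / F x) atTop (nhds (2 ^ (-α)))) :
    ∃ C x₀ : ℝ, 0 < C ∧ 0 < x₀ ∧ ∀ x ≥ x₀, ∀ t ≥ (1 : ℝ), F (x / t) ≤ C * t ^ p * F x := by
  have hlt : (2 : ℝ) ^ (-p) < 2 ^ (-α) :=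
    Real.rpow_lt_rpow_of_exponent_lt (by norm_num) (by linarith)
  obtain ⟨x₁, hx₁⟩ := eventually_atTop.1 (hRV.eventually_const_lt hlt)
  set x₀ := max x₁ 1
  have hx₀ : 0 < x₀ := lt_max_of_lt_right one_pos
  have hstep : ∀ x ≥ x₀, F x ≤ 2 ^ p * F (2 * x) := by
    intro x hx
    have h := hx₁ x ((le_max_left _ _).trans hx)
    rw [lt_div_iff₀ (hpos x (hx₀.trans_le hx)), Real.rpow_neg (by norm_num)] at h
    have h2 : (0 : ℝ) < 2 ^ p := by positivity
    rw [inv_mul_lt_iff₀ h2] at h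
    exact h.le
  have hiter : ∀ k : ℕ, ∀ x ≥ x₀, F x ≤ (2 ^ p) ^ k * F (2 ^ k * x) := by
    intro k
    induction k with
    | zero => intro x _; simp
    | succ k ih =>
      intro x hx
      have h1 : x₀ ≤ 2 ^ k * x :=
        hx.trans (le_mul_of_one_le_left (hx₀.le.trans hx) (one_le_pow₀ (by norm_num)))
      calc F x ≤ (2 ^ p) ^ k * F (2 ^ k * x) := ih x hx
        _ ≤ (2 ^ p) ^ k * (2 ^ p * F (2 * (2 ^ k * x))) := by gcongr; exact hstep _ h1
        _ = _ := by rw [pow_succ, pow_succ]; ring_nf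
  have hlarge : ∀ x t : ℝ, x₀ ≤ x → 1 ≤ t → x₀ ≤ x / t → F (x / t) ≤ (2 * t) ^ p * F x := by
    intro x t hx ht hxt
    obtain ⟨k, hk1, hk2⟩ := exists_nat_pow_near ht (one_lt_two)
    have ht0 : 0 < t := by linarith
    calc F (x / t) ≤ (2 ^ p) ^ (k + 1) * F (2 ^ (k + 1) * (x / t)) := hiter _ _ hxt
      _ ≤ (2 ^ p) ^ (k + 1) * F x := by
        gcongr
        apply hanti
        rw [mul_div_assoc', le_div_iff₀ ht0, mul_comm]
        exact mul_le_mul_of_nonneg_right hk2.le (hx₀.le.trans hx)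
      _ ≤ (2 * t) ^ p * F x := by
        gcongr
        · exact (hpos x (hx₀.trans_le hx)).le
        rw [← Real.rpow_mul_natCast (by norm_num), mul_comm p, Real.rpow_natCast_mul (by norm_num)]
        gcongr
        rw [pow_succ]; linarith
  have hF₀ := hpos x₀ hx₀
  refine ⟨2 ^ p / F x₀, x₀, by positivity, hx₀, fun x hx t ht => ?_⟩
  have hx0 : 0 < x := hx₀.trans_le hx
  have hFx := hpos x hx0
  have ht0 : 0 < t := by linarith
  rcases le_total x₀ (x / t) with h | h
  · refine (hlarge x t hx ht h).trans ?_
    rw [Real.mul_rpow (by norm_num) ht0.le, div_mul_eq_mul_div]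
    gcongr
    rw [le_div_iff₀ hF₀]
    exact mul_le_of_le_one_right (by positivity) (hle _)
  · have hs : 1 ≤ x / x₀ := by rwa [one_le_div hx₀]
    have h1 := hlarge x (x / x₀) hx hs (by rw [div_div_cancel₀ hx0.ne'])
    rw [div_div_cancel₀ hx0.ne'] at h1
    have h2 : x / x₀ ≤ t := by rwa [div_le_iff₀ hx₀, mul_comm, ← div_le_iff₀ ht0]
    calc F (x / t) ≤ 1 := hle _
      _ = F x₀ / F x₀ := (div_self hF₀.ne').symm
      _ ≤ ((2 * t) ^ p * F x) / F x₀ := by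
        gcongr
        refine h1.trans ?_
        gcongr
      _ = _ := by rw [Real.mul_rpow (by norm_num) ht0.le]; ring

theorem measurable_apply_nat {A B : Type*} [MeasurableSpace A] [MeasurableSpace B] {f : ℕ → A → B}
    (hf : ∀ n, Measurable (f n)) {N : A → ℕ} (hN : Measurable N) :
    Measurable fun a => f (N a) a :=
  (measurable_from_prod_countable_right hf :
    Measurable fun z : ℕ × A => f z.1 z.2).comp (hN.prodMk measurable_id)

theorem Tuple.measurable_comp_sort (n : ℕ) :
    Measurable fun v : Fin n → ℝ => v ∘ Tuple.sort v := by
  have hset : ∀ σ : Equiv.Perm (Fin n), MeasurableSet {v : Fin n → ℝ | Tuple.sort v = σ} := by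
    intro σ
    have : {v : Fin n → ℝ | Tuple.sort v = σ} = {v | (∀ i j, i ≤ j → v (σ i) ≤ v (σ j)) ∧
        ∀ i j, i < j → v (σ i) = v (σ j) → σ i < σ j} := by
      ext v
      exact eq_comm.trans Tuple.eq_sort_iff
    rw [this]
    have hle : ∀ i j, MeasurableSet {v : Fin n → ℝ | v i ≤ v j} := fun i j =>
      measurableSet_le (measurable_pi_apply i) (measurable_pi_apply j)
    have heq : ∀ i j, MeasurableSet {v : Fin n → ℝ | v i = v j} := fun i j =>
      measurableSet_eq_fun (measurable_pi_apply i) (measurable_pi_apply j)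
    simp only [measurableSet_setOfPred] at hle heq ⊢
    refine Measurable.and ?_ ?_ <;>
      refine Measurable.forall fun i => Measurable.forall fun j => measurable_const.imp ?_
    · exact hle _ _
    · exact (heq _ _).imp measurable_const
  intro B hB
  have : (fun v : Fin n → ℝ => v ∘ Tuple.sort v) ⁻¹' B =
      ⋃ σ : Equiv.Perm (Fin n), {v | Tuple.sort v = σ} ∩ (fun v => v ∘ σ) ⁻¹' B := by
    ext v
    simp
  rw [this]
  refine MeasurableSet.iUnion fun σ => (hset σ).inter ?_
  exact (measurable_pi_lambda _ fun i => measurable_pi_apply _) hB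

theorem Finset.sum_Icc_one_eq_sum_fin {M : Type*} [AddCommMonoid M] (f : ℕ → M) (n : ℕ) :
    ∑ i ∈ Finset.Icc 1 n, f i = ∑ i : Fin n, f (i + 1) := by
  rw [← Finset.sum_range (fun i => f (i + 1)), ← Finset.Ico_succ_right_eq_Icc,
    Finset.sum_Ico_eq_sum_range]
  simp [add_comm]

theorem lintegral_ofReal_exp_rpow {T α : ℝ} (hT : 0 < T) (hα : 0 < α) (v : ℝ) :
    0 ≤ (if v = 0 then T else (1 - Real.exp (-(α * v * T))) / (α * v)) ∧
    ∫⁻ t in Set.Icc 0 T, ENNReal.ofReal (Real.exp (-(v * (T - t))) ^ α) =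
      ENNReal.ofReal (if v = 0 then T else (1 - Real.exp (-(α * v * T))) / (α * v)) := by
  have hint : ∫ t in Set.Icc 0 T, Real.exp (-(v * (T - t))) ^ α =
      if v = 0 then T else (1 - Real.exp (-(α * v * T))) / (α * v) := by
    simp only [← Real.exp_mul]
    rw [integral_Icc_eq_integral_Ioc, ← intervalIntegral.integral_of_le hT.le]
    split_ifs with hv
    · simp [hv]
    · have hav : α * v ≠ 0 := mul_ne_zero hα.ne' hv
      have hderiv : ∀ t ∈ Set.uIcc 0 T,
          HasDerivAt (fun t => Real.exp (-(v * (T - t)) * α) / (α * v))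
            (Real.exp (-(v * (T - t)) * α)) t := by
        intro t _
        have h1 : HasDerivAt (fun t => -(v * (T - t)) * α) (α * v) t := by
          have := ((((hasDerivAt_id t).const_sub T).const_mul v).neg).mul_const α
          exact this.congr_deriv (by ring)
        exact (h1.exp.div_const (α * v)).congr_deriv (mul_div_cancel_right₀ _ hav)
      rw [intervalIntegral.integral_eq_sub_of_hasDerivAt hderiv
        (Continuous.intervalIntegrable (by fun_prop) _ _)]
      rw [← sub_div]
      simp only [sub_self, mul_zero, neg_zero, zero_mul, Real.exp_zero, sub_zero]
      ring_nf
  have hcont : Continuous fun t : ℝ => Real.exp (-(v * (T - t))) ^ α := by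
    simp only [← Real.exp_mul]
    fun_prop
  have hnonneg : ∀ t : ℝ, 0 ≤ Real.exp (-(v * (T - t))) ^ α := fun t => by positivity
  rw [← hint, ofReal_integral_eq_lintegral_ofReal (hcont.integrableOn_Icc)
    (Eventually.of_forall hnonneg)]
  exact ⟨integral_nonneg hnonneg, rfl⟩

theorem lintegral_comp_nat {Ω : Type*} [MeasurableSpace Ω] {P : Measure Ω} {N : Ω → ℕ}
    (hN : Measurable N) (f : ℕ → ENNReal) :
    ∫⁻ ω, f (N ω) ∂P = ∑' n, f n * P {ω | N ω = n} := by
  rw [← lintegral_map (measurable_of_countable f) hN, lintegral_countable']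
  congr with n
  rw [Measure.map_apply hN (measurableSet_singleton n)]
  rfl

theorem lintegral_rpow_mul_poisson_lt_top {Ω : Type*} [MeasurableSpace Ω] {P : Measure Ω}
    {N : Ω → ℕ} (hN : Measurable N) {r : ℝ} (hr : 0 < r)
    (hpois : ∀ k : ℕ, P {ω | N ω = k} =
      ENNReal.ofReal (Real.exp (-r) * r ^ k / (Nat.factorial k))) (p : ℝ) :
    ∫⁻ ω, ENNReal.ofReal ((N ω : ℝ) ^ p) * (N ω : ENNReal) ∂P < ⊤ := by
  rw [lintegral_comp_nat hN fun n => ENNReal.ofReal ((n : ℝ) ^ p) * n]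
  obtain ⟨m, hm⟩ := exists_nat_ge p
  have hbound : ∀ n : ℕ, (n : ℝ) ^ p * n ≤ (m + 1).factorial * Real.exp 1 ^ n := by
    intro n
    rcases Nat.eq_zero_or_pos n with rfl | hn
    · simp
    have hn1 : (1 : ℝ) ≤ n := by exact_mod_cast hn
    have h1 : (n : ℝ) ^ p ≤ n ^ m := by
      rw [← Real.rpow_natCast]
      exact Real.rpow_le_rpow_of_exponent_le hn1 hm
    have h2 := Real.pow_div_factorial_le_exp (n : ℝ) (by positivity) (m + 1)
    rw [div_le_iff₀ (by positivity)] at h2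
    calc (n : ℝ) ^ p * n ≤ n ^ m * n := by gcongr
      _ = n ^ (m + 1) := (pow_succ _ _).symm
      _ ≤ _ := by rw [← Real.exp_nat_mul, mul_one, mul_comm]; exact h2
  have hsum : Summable fun n : ℕ => ((m + 1).factorial * Real.exp (-r)) *
      ((Real.exp 1 * r) ^ n / n.factorial) := (Real.summable_pow_div_factorial _).mul_left _
  refine lt_of_le_of_lt (ENNReal.tsum_le_tsum fun n => ?_) hsum.tsum_ofReal_lt_top
  rw [hpois, ← ENNReal.ofReal_natCast, ← ENNReal.ofReal_mul (by positivity),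
    ← ENNReal.ofReal_mul (by positivity)]
  refine ENNReal.ofReal_le_ofReal ?_
  calc _ ≤ ((m + 1).factorial * Real.exp 1 ^ n) * (Real.exp (-r) * r ^ n / n.factorial) := by
        exact mul_le_mul_of_nonneg_right (hbound n) (by positivity)
    _ = _ := by rw [mul_pow]; ring

theorem lintegral_sum_arrival {Ω : Type*} [MeasurableSpace Ω] {P : Measure Ω}
    {N : Ω → ℕ} (hN : Measurable N) {V Ta : ℕ → Ω → ℝ}
    (hV : ∀ i, Measurable (V i)) (hVid : ∀ i, IdentDistrib (V i) (V 0) P P)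
    (hTa : ∀ i, Measurable (Ta i))
    (hOS : ∀ n : ℕ, ∀ B : Set (Fin n → ℝ), MeasurableSet B →
      P {ω | (fun i : Fin n => Ta ((i : ℕ) + 1) ω) ∈ B ∧ N ω = n} =
        P {ω | (fun i : Fin n =>
            V (((Tuple.sort (fun k : Fin n => V ((k : ℕ) + 1) ω)) i : ℕ) + 1) ω) ∈ B}
          * P {ω | N ω = n})
    {G : ℝ → ENNReal} (hG : Measurable G) :
    ∫⁻ ω, ∑ i ∈ Finset.Icc 1 (N ω), G (Ta i ω) ∂P =
      (∫⁻ ω, (N ω : ENNReal) ∂P) * ∫⁻ ω, G (V 0 ω) ∂P := by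
  have hset : ∀ n, MeasurableSet {ω | N ω = n} := fun n => hN (measurableSet_singleton n)
  have hfix : ∀ n : ℕ, ∫⁻ ω in {ω | N ω = n}, ∑ i ∈ Finset.Icc 1 (N ω), G (Ta i ω) ∂P =
      n * P {ω | N ω = n} * ∫⁻ ω, G (V 0 ω) ∂P := by
    intro n
    have hTv : Measurable fun ω => fun i : Fin n => Ta ((i : ℕ) + 1) ω :=
      measurable_pi_lambda _ fun i => hTa _
    have hVv : Measurable fun ω => fun i : Fin n => V ((i : ℕ) + 1) ω :=
      measurable_pi_lambda _ fun i => hV _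
    have hVs := (Tuple.measurable_comp_sort n).comp hVv
    have hmap : (P.restrict {ω | N ω = n}).map (fun ω => fun i : Fin n => Ta ((i : ℕ) + 1) ω) =
        P {ω | N ω = n} • P.map
          ((fun v : Fin n → ℝ => v ∘ Tuple.sort v) ∘ fun ω => fun i : Fin n => V (i + 1) ω) := by
      ext B hB
      rw [Measure.map_apply hTv hB, Measure.restrict_apply (hTv hB), Measure.smul_apply,
        Measure.map_apply hVs hB, smul_eq_mul, mul_comm]
      exact hOS n B hB
    have hH : Measurable fun v : Fin n → ℝ => ∑ i, G (v i) :=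
      Finset.measurable_sum _ fun i _ => hG.comp (measurable_pi_apply i)
    calc ∫⁻ ω in {ω | N ω = n}, ∑ i ∈ Finset.Icc 1 (N ω), G (Ta i ω) ∂P
        = ∫⁻ ω in {ω | N ω = n}, ∑ i : Fin n, G (Ta ((i : ℕ) + 1) ω) ∂P := by
          refine setLIntegral_congr_fun (hset n) fun ω hω => ?_
          have hω' : N ω = n := hω
          simp only [hω', Finset.sum_Icc_one_eq_sum_fin]
      _ = P {ω | N ω = n} * ∫⁻ ω, ∑ i : Fin n, G (V ((i : ℕ) + 1) ω) ∂P := by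
          rw [← lintegral_map hH hTv, hmap, lintegral_smul_measure, lintegral_map hH hVs,
            smul_eq_mul]
          congr 1
          refine lintegral_congr fun ω => ?_
          exact Equiv.sum_comp (Tuple.sort fun k : Fin n => V ((k : ℕ) + 1) ω)
            fun i => G (V ((i : ℕ) + 1) ω)
      _ = _ := by
          have hGV : ∀ i : Fin n, Measurable fun ω => G (V ((i : ℕ) + 1) ω) := fun i =>
            hG.comp (hV _)
          rw [lintegral_finsetSum _ fun i _ => hGV i]
          have : ∀ i : Fin n, ∫⁻ ω, G (V ((i : ℕ) + 1) ω) ∂P = ∫⁻ ω, G (V 0 ω) ∂P := fun i =>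
            ((hVid _).comp hG).lintegral_eq
          simp only [this, Finset.sum_const, Finset.card_univ, Fintype.card_fin, nsmul_eq_mul]
          ring
  have hU : ⋃ n, {ω | N ω = n} = Set.univ := by ext; simp
  rw [lintegral_comp_nat hN fun n => (n : ENNReal), ← ENNReal.tsum_mul_right,
    ← setLIntegral_univ, ← hU, lintegral_iUnion hset]
  · exact tsum_congr hfix
  · intro i j hij
    exact Set.disjoint_left.2 fun ω h1 h2 => hij (h1.symm.trans h2)

section
variable {Ω : Type*} [MeasurableSpace Ω] {P : Measure Ω} [IsProbabilityMeasure P]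

theorem tendsto_tail_add {U W : Ω → ℝ} (hWm : Measurable W)
    (hU0 : ∀ ω, 0 ≤ U ω) (hW0 : ∀ ω, 0 ≤ W ω) {D : ℝ → ℝ} (hD : ∀ x, 0 ≤ D x) {a b α : ℝ}
    (hU : ∀ t : ℝ, 0 < t →
      Tendsto (fun x => P.real {ω | t * x < U ω} / D x) atTop (nhds (a * t ^ (-α))))
    (hW : ∀ t : ℝ, 0 < t →
      Tendsto (fun x => P.real {ω | t * x < W ω} / D x) atTop (nhds (b * t ^ (-α))))
    (hUW : ∀ t : ℝ, 0 < t →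
      Tendsto (fun x => P.real {ω | t * x < U ω ∧ t * x < W ω} / D x) atTop (nhds 0))
    (t : ℝ) (ht : 0 < t) :
    Tendsto (fun x => P.real {ω | t * x < U ω + W ω} / D x) atTop
      (nhds ((a + b) * t ^ (-α))) := by
  refine tendsto_order.2 ⟨fun u hu => ?_, fun u hu => ?_⟩
  · have h := ((hU t ht).add (hW t ht)).sub (hUW t ht)
    rw [sub_zero, ← add_mul] at h
    filter_upwards [h.eventually_const_lt hu] with x hx
    refine hx.trans_le ?_
    rw [← add_div, ← sub_div]
    refine div_le_div_of_nonneg_right ?_ (hD x)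
    have hm : MeasurableSet {ω | t * x < W ω} := measurableSet_lt measurable_const hWm
    have h1 := measureReal_union_add_inter (μ := P) (s := {ω | t * x < U ω}) hm
    have h2 : P.real ({ω | t * x < U ω} ∪ {ω | t * x < W ω}) ≤ P.real {ω | t * x < U ω + W ω} := by
      refine measureReal_mono ?_
      rintro ω (h | h)
      · exact lt_of_lt_of_le h (le_add_of_nonneg_right (hW0 ω))
      · exact lt_of_lt_of_le h (le_add_of_nonneg_left (hU0 ω))
    have h3 : {ω | t * x < U ω ∧ t * x < W ω} = {ω | t * x < U ω} ∩ {ω | t * x < W ω} := rfl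
    rw [h3]
    linarith
  · have hcont : Tendsto (fun δ : ℝ => (a + b) * ((1 - δ) * t) ^ (-α)) (nhdsWithin 0 (Set.Ioi 0))
        (nhds ((a + b) * t ^ (-α))) := by
      have : ContinuousAt (fun δ : ℝ => (a + b) * ((1 - δ) * t) ^ (-α)) 0 := by
        refine continuousAt_const.mul (ContinuousAt.rpow_const (by fun_prop) (Or.inl ?_))
        simpa using ht.ne'
      have h := this.tendsto
      simp only [sub_zero, one_mul] at h
      exact h.mono_left nhdsWithin_le_nhds
    obtain ⟨δ, hδu, hδ0, hδ1⟩ := ((hcont.eventually_lt_const hu).and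
      (Ioo_mem_nhdsGT (zero_lt_one' ℝ))).exists
    have hs : 0 < (1 - δ) * t := mul_pos (by linarith) ht
    have h := ((hU _ hs).add (hW _ hs)).add (hUW _ (mul_pos hδ0 ht))
    rw [add_zero, ← add_mul] at h
    filter_upwards [h.eventually_lt_const hδu] with x hx
    refine lt_of_le_of_lt ?_ hx
    rw [← add_div, ← add_div]
    refine div_le_div_of_nonneg_right ?_ (hD x)
    calc P.real {ω | t * x < U ω + W ω}
        ≤ P.real (({ω | (1 - δ) * t * x < U ω} ∪ {ω | (1 - δ) * t * x < W ω}) ∪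
          {ω | δ * t * x < U ω ∧ δ * t * x < W ω}) := by
          refine measureReal_mono ?_
          intro ω hω
          simp only [Set.mem_ofPred_eq, Set.mem_union] at hω ⊢
          by_contra! hc
          obtain ⟨⟨h1, h2⟩, h3⟩ := hc
          have h4 : δ * t * x < U ω := by linarith
          linarith [h3 h4]
      _ ≤ _ := (measureReal_union_le _ _).trans (by gcongr; exact measureReal_union_le _ _)

theorem tendsto_joint_tail_add {U U' W : Ω → ℝ} {D : ℝ → ℝ} (hD : ∀ x, 0 ≤ D x)
    (hU : ∀ t : ℝ, 0 < t →
      Tendsto (fun x => P.real {ω | t * x < U ω ∧ t * x < W ω} / D x) atTop (nhds 0))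
    (hU' : ∀ t : ℝ, 0 < t →
      Tendsto (fun x => P.real {ω | t * x < U' ω ∧ t * x < W ω} / D x) atTop (nhds 0))
    (t : ℝ) (ht : 0 < t) :
    Tendsto (fun x => P.real {ω | t * x < U ω + U' ω ∧ t * x < W ω} / D x) atTop (nhds 0) := by
  have h := (hU (t / 2) (by positivity)).add (hU' (t / 2) (by positivity))
  rw [add_zero] at h
  refine squeeze_zero' (Eventually.of_forall fun x => div_nonneg measureReal_nonneg (hD x)) ?_ h
  filter_upwards [eventually_ge_atTop 0] with x hx
  rw [← add_div]
  refine div_le_div_of_nonneg_right ((measureReal_mono ?_).trans (measureReal_union_le _ _)) (hD x)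
  rintro ω ⟨h1, h2⟩
  simp only [Set.mem_ofPred_eq, Set.mem_union]
  have h3 : 0 ≤ t * x := by positivity
  by_contra! hc
  have h4 : t / 2 * x < W ω := by linarith
  by_cases h5 : t / 2 * x < U ω
  · linarith [hc.1 h5]
  · by_cases h6 : t / 2 * x < U' ω
    · linarith [hc.2 h6]
    · linarith

theorem tendsto_tail_sum {X : ℕ → Ω → ℝ} (hXm : ∀ i, Measurable (X i)) (hX0 : ∀ i ω, 0 ≤ X i ω)
    {D : ℝ → ℝ} (hD : ∀ x, 0 ≤ D x) {α : ℝ} {S : Set ℕ}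
    (hX : ∀ i ∈ S, ∀ t : ℝ, 0 < t →
      Tendsto (fun x => P.real {ω | t * x < X i ω} / D x) atTop (nhds (t ^ (-α))))
    (hXX : ∀ i ∈ S, ∀ j ∈ S, i ≠ j → ∀ t : ℝ, 0 < t →
      Tendsto (fun x => P.real {ω | t * x < X i ω ∧ t * x < X j ω} / D x) atTop (nhds 0))
    {c : ℕ → ℝ} (hc : ∀ i, 0 < c i) (s : Finset ℕ) (hs : ↑s ⊆ S) (t : ℝ) (ht : 0 < t) :
    Tendsto (fun x => P.real {ω | t * x < ∑ i ∈ s, X i ω * c i} / D x) atTop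
      (nhds ((∑ i ∈ s, c i ^ α) * t ^ (-α))) := by
  have hempty : ∀ x : ℝ, 0 ≤ x → ∀ t : ℝ, 0 < t → ¬ t * x < 0 := fun x hx t ht =>
    not_lt.2 (by positivity)
  have hsingle : ∀ i ∈ S, ∀ t : ℝ, 0 < t →
      Tendsto (fun x => P.real {ω | t * x < X i ω * c i} / D x) atTop
        (nhds (c i ^ α * t ^ (-α))) := by
    intro i hi t ht
    have h := hX i hi (t / c i) (div_pos ht (hc i))
    rw [Real.div_rpow ht.le (hc i).le, Real.rpow_neg (hc i).le, div_inv_eq_mul, mul_comm] at h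
    simpa only [div_mul_eq_mul_div, div_lt_iff₀ (hc i)] using h
  have hpair : ∀ i ∈ S, ∀ j ∈ S, i ≠ j → ∀ t : ℝ, 0 < t →
      Tendsto (fun x => P.real {ω | t * x < X i ω * c i ∧ t * x < X j ω * c j} / D x)
        atTop (nhds 0) := by
    intro i hi j hj hij t ht
    have hm : 0 < max (c i) (c j) := lt_max_of_lt_left (hc i)
    have h := hXX i hi j hj hij (t / max (c i) (c j)) (div_pos ht hm)
    refine squeeze_zero (fun x => div_nonneg measureReal_nonneg (hD x)) (fun x => ?_) h
    refine div_le_div_of_nonneg_right (measureReal_mono ?_) (hD x)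
    rintro ω ⟨h1, h2⟩
    simp only [Set.mem_ofPred_eq]
    rw [div_mul_eq_mul_div, div_lt_iff₀ hm, div_lt_iff₀ hm]
    exact ⟨h1.trans_le (mul_le_mul_of_nonneg_left (le_max_left _ _) (hX0 i ω)),
      h2.trans_le (mul_le_mul_of_nonneg_left (le_max_right _ _) (hX0 j ω))⟩
  have hjoint : ∀ j ∈ S, ∀ s : Finset ℕ, ↑s ⊆ S → j ∉ s → ∀ t : ℝ, 0 < t →
      Tendsto (fun x => P.real {ω | t * x < ∑ i ∈ s, X i ω * c i ∧ t * x < X j ω * c j} / D x)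
        atTop (nhds 0) := by
    intro j hj s
    induction s using Finset.induction_on with
    | empty =>
      intro _ _ t ht
      refine tendsto_const_nhds.congr' ?_
      filter_upwards [eventually_ge_atTop 0] with x hx
      simp [hempty x hx t ht]
    | insert i s his ih =>
      intro hs hjs
      rw [Finset.coe_insert, Set.insert_subset_iff] at hs
      rw [Finset.mem_insert, not_or] at hjs
      simp only [Finset.sum_insert his]
      exact tendsto_joint_tail_add hD
        (hpair i hs.1 j hj (Ne.symm hjs.1)) (ih hs.2 hjs.2)
  induction s using Finset.induction_on generalizing t with
  | empty =>
    simp only [Finset.sum_empty, zero_mul]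
    refine tendsto_const_nhds.congr' ?_
    filter_upwards [eventually_ge_atTop 0] with x hx
    simp [hempty x hx t ht]
  | insert i s his ih =>
    rw [Finset.coe_insert, Set.insert_subset_iff] at hs
    simp only [Finset.sum_insert his, add_comm (X i _ * c i), add_comm (c i ^ α)]
    exact tendsto_tail_add
      ((hXm i).mul_const _)
      (fun ω => Finset.sum_nonneg fun i _ => mul_nonneg (hX0 i ω) (hc i).le)
      (fun ω => mul_nonneg (hX0 i ω) (hc i).le) hD (ih hs.2) (hsingle i hs.1)
      (hjoint i hs.1 s hs.2 his) t ht

theorem ProbabilityTheory.IndepFun.lintegral_uncurry {A B : Type*} [MeasurableSpace A]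
    [MeasurableSpace B] {f : Ω → A} {g : Ω → B} (h : IndepFun f g P) (hf : Measurable f)
    (hg : Measurable g) {F : A → B → ENNReal} (hF : Measurable fun z : A × B => F z.1 z.2) :
    ∫⁻ ω, F (f ω) (g ω) ∂P = ∫⁻ ω', ∫⁻ ω, F (f ω) (g ω') ∂P ∂P := by
  have hP := (indepFun_iff_map_prod_eq_prod_map_map hf.aemeasurable hg.aemeasurable).1 h
  have := Measure.isProbabilityMeasure_map (μ := P) hf.aemeasurable
  have := Measure.isProbabilityMeasure_map (μ := P) hg.aemeasurable
  rw [← lintegral_map (f := fun z : A × B => F z.1 z.2) hF (hf.prodMk hg), hP,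
    lintegral_prod_symm' _ hF, lintegral_map hF.lintegral_prod_left' hg]
  refine lintegral_congr fun ω' => ?_
  exact lintegral_map (hF.comp measurable_prodMk_right) hf

theorem lintegral_poisson {N : Ω → ℕ} (hN : Measurable N) {r : ℝ} (hr : 0 < r)
    (hpois : ∀ k : ℕ, P {ω | N ω = k} =
      ENNReal.ofReal (Real.exp (-r) * r ^ k / (Nat.factorial k))) :
    ∫⁻ ω, (N ω : ENNReal) ∂P = ENNReal.ofReal r := by
  have hone : ∑' k, P {ω | N ω = k} = 1 := by
    simpa using (lintegral_comp_nat (P := P) hN fun _ => 1).symm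
  rw [lintegral_comp_nat hN, tsum_eq_zero_add' ENNReal.summable]
  calc _ = ∑' k, ENNReal.ofReal r * P {ω | N ω = k} := by
        rw [Nat.cast_zero, zero_mul, zero_add]
        congr with k
        rw [hpois, hpois, ← ENNReal.ofReal_natCast, ← ENNReal.ofReal_mul (by positivity),
          ← ENNReal.ofReal_mul hr.le, Nat.factorial_succ, Nat.cast_mul]
        congr 1
        field_simp
        ring
    _ = ENNReal.ofReal r := by rw [ENNReal.tsum_mul_left, hone, mul_one]

theorem measureReal_lt_sum_le {X : ℕ → Ω → ℝ} (hX0 : ∀ i ω, 0 ≤ X i ω) {F : ℝ → ℝ} {C x₀ p : ℝ}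
    (hx₀ : 0 < x₀) (hF : ∀ x ≥ x₀, ∀ t ≥ (1 : ℝ), F (x / t) ≤ C * t ^ p * F x) {s : Finset ℕ}
    (hX : ∀ i ∈ s, ∀ y, P.real {ω | y < X i ω} = F y) {c m : ℕ → ℝ}
    (hcm : ∀ i ∈ s, c i ≤ m i) (hm : ∀ i ∈ s, 1 ≤ m i) {x : ℝ} (hx : x₀ ≤ x) :
    P.real {ω | x < ∑ i ∈ s, X i ω * c i} ≤ C * (∑ i ∈ s, (s.card * m i) ^ p) * F x := by
  have hx0 : 0 < x := hx₀.trans_le hx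
  have hsub : {ω | x < ∑ i ∈ s, X i ω * c i} ⊆ ⋃ i ∈ s, {ω | x / (s.card * m i) < X i ω} := by
    intro ω hω
    simp only [Set.mem_iUnion, Set.mem_ofPred_eq, exists_prop] at hω ⊢
    by_contra! h
    refine hω.not_ge ?_
    calc ∑ i ∈ s, X i ω * c i ≤ ∑ i ∈ s, x / s.card := by
          refine Finset.sum_le_sum fun i hi => ?_
          have hmi : 0 < m i := one_pos.trans_le (hm i hi)
          calc X i ω * c i ≤ X i ω * m i := mul_le_mul_of_nonneg_left (hcm i hi) (hX0 i ω)
            _ ≤ x / (s.card * m i) * m i := mul_le_mul_of_nonneg_right (h i hi) hmi.le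
            _ = x / s.card := by field_simp
      _ ≤ x := by
          rw [Finset.sum_const, nsmul_eq_mul]
          rcases s.card.eq_zero_or_pos with h0 | h0
          · simp [h0, hx0.le]
          · exact (mul_div_cancel₀ x (by positivity)).le
  calc _ ≤ ∑ i ∈ s, P.real {ω | x / (s.card * m i) < X i ω} :=
        (measureReal_mono hsub (measure_ne_top P _)).trans (measureReal_biUnion_finset_le _ _)
    _ ≤ ∑ i ∈ s, C * (s.card * m i) ^ p * F x := by
        refine Finset.sum_le_sum fun i hi => ?_
        rw [hX i hi]
        refine hF x hx _ (one_le_mul_of_one_le_of_one_le ?_ (hm i hi))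
        exact_mod_cast Finset.card_pos.2 ⟨i, hi⟩
    _ = _ := by rw [← Finset.sum_mul, ← Finset.mul_sum]

theorem measurable_sum_Icc_one : Measurable fun z : (ℕ → ℝ) × ℕ × (ℕ → ℝ) =>
    ∑ i ∈ Finset.Icc 1 z.2.1, z.1 i * z.2.2 i :=
  measurable_apply_nat
    (f := fun n (z : (ℕ → ℝ) × ℕ × (ℕ → ℝ)) => ∑ i ∈ Finset.Icc 1 n, z.1 i * z.2.2 i)
    (fun n => Finset.measurable_sum _ fun i _ => by fun_prop) (by fun_prop)

theorem measure_lt_sum_Icc_one {X θ : ℕ → Ω → ℝ} {N : Ω → ℕ} (hX : ∀ i, Measurable (X i))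
    (hθ : ∀ i, Measurable (θ i)) (hN : Measurable N)
    (h : IndepFun (fun ω => fun i => X i ω) (fun ω => (N ω, fun i => θ i ω)) P) (x : ℝ) :
    (Measurable fun ω' => P.real {ω | x < ∑ i ∈ Finset.Icc 1 (N ω'), X i ω * θ i ω'}) ∧
    P.real {ω | x < ∑ i ∈ Finset.Icc 1 (N ω), X i ω * θ i ω} =
      ∫ ω', P.real {ω | x < ∑ i ∈ Finset.Icc 1 (N ω'), X i ω * θ i ω'} ∂P := by
  have hXm : Measurable fun ω => fun i => X i ω := measurable_pi_lambda _ hX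
  have hZm : Measurable fun ω => (N ω, fun i => θ i ω) := hN.prodMk (measurable_pi_lambda _ hθ)
  have hS : MeasurableSet {z : (ℕ → ℝ) × ℕ × (ℕ → ℝ) |
      x < ∑ i ∈ Finset.Icc 1 z.2.1, z.1 i * z.2.2 i} :=
    measurableSet_lt measurable_const measurable_sum_Icc_one
  have hm : Measurable fun ω' => P {ω | x < ∑ i ∈ Finset.Icc 1 (N ω'), X i ω * θ i ω'} :=
    measurable_measure_prodMk_right (μ := P)
      (((hXm.comp measurable_fst).prodMk (hZm.comp measurable_snd)) hS)
  refine ⟨hm.ennreal_toReal, ?_⟩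
  have hF := h.lintegral_uncurry hXm hZm
    (F := fun a b => Set.indicator {z : (ℕ → ℝ) × ℕ × (ℕ → ℝ) |
      x < ∑ i ∈ Finset.Icc 1 z.2.1, z.1 i * z.2.2 i} 1 (a, b)) (measurable_one.indicator hS)
  have hind : ∀ f : Ω → (ℕ → ℝ) × ℕ × (ℕ → ℝ), Measurable f →
      ∫⁻ ω, Set.indicator {z : (ℕ → ℝ) × ℕ × (ℕ → ℝ) |
        x < ∑ i ∈ Finset.Icc 1 z.2.1, z.1 i * z.2.2 i} 1 (f ω) ∂P =
      P {ω | x < ∑ i ∈ Finset.Icc 1 (f ω).2.1, (f ω).1 i * (f ω).2.2 i} := by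
    intro f hf
    exact lintegral_indicator_one (hf hS)
  rw [hind _ (hXm.prodMk hZm)] at hF
  have hF' : P {ω | x < ∑ i ∈ Finset.Icc 1 (N ω), X i ω * θ i ω} =
      ∫⁻ ω', P {ω | x < ∑ i ∈ Finset.Icc 1 (N ω'), X i ω * θ i ω'} ∂P :=
    hF.trans (lintegral_congr fun ω' => hind _ (hXm.prodMk measurable_const))
  rw [measureReal_def, hF']
  exact (integral_toReal hm.aemeasurable (Eventually.of_forall fun _ => measure_lt_top _ _)).symm

/-- Single big jump principle for a randomly stopped, randomly weighted sum: the weights are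
dominated by `m`, and `N` and `m` have enough moments. -/
theorem tendsto_tail_random_weighted_sum {X θ m : ℕ → Ω → ℝ} {N : Ω → ℕ}
    (hX : ∀ i, Measurable (X i)) (hX0 : ∀ i ω, 0 ≤ X i ω)
    (hθ : ∀ i, Measurable (θ i)) (hθ0 : ∀ i ω, 0 < θ i ω)
    (hN : Measurable N)
    (hXid : ∀ i, 1 ≤ i → IdentDistrib (X i) (X 1) P P) {α p : ℝ} (hα : 0 < α) (hp : α < p)
    (hRVpos : ∀ x : ℝ, 0 < x → 0 < P {ω | x < X 1 ω})
    (hRV : ∀ t : ℝ, 0 < t →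
      Tendsto (fun x => (P {ω | t * x < X 1 ω}).toReal / (P {ω | x < X 1 ω}).toReal)
        atTop (nhds (t ^ (-α))))
    (hUAI : ∀ ε : ℝ, 0 < ε → ∃ x₀ : ℝ, ∀ x ≥ x₀, ∀ i j : ℕ, 1 ≤ i → 1 ≤ j → i ≠ j →
      (P {ω | x < X i ω ∧ x < X j ω}).toReal ≤ ε * (P {ω | x < X 1 ω}).toReal)
    (h : IndepFun (fun ω => fun i => X i ω) (fun ω => (N ω, fun i => θ i ω)) P)
    (hm1 : ∀ i ω, 1 ≤ m i ω) (hθm : ∀ᵐ ω ∂P, ∀ i ∈ Finset.Icc 1 (N ω), θ i ω ≤ m i ω)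
    (hint : Integrable (fun ω => ∑ i ∈ Finset.Icc 1 (N ω), ((N ω : ℝ) * m i ω) ^ p) P) :
    Tendsto (fun x => P.real {ω | x < ∑ i ∈ Finset.Icc 1 (N ω), X i ω * θ i ω} /
        P.real {ω | x < X 1 ω}) atTop
      (nhds (∫ ω, ∑ i ∈ Finset.Icc 1 (N ω), θ i ω ^ α ∂P)) := by
  set F : ℝ → ℝ := fun x => P.real {ω | x < X 1 ω} with hFdef
  have hF0 : ∀ x, 0 ≤ F x := fun x => measureReal_nonneg
  have hFpos : ∀ x, 0 < x → 0 < F x := fun x hx =>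
    ENNReal.toReal_pos (hRVpos x hx).ne' (measure_ne_top _ _)
  have hFanti : Antitone F := fun x y hxy =>
    measureReal_mono (fun ω (hω : y < X 1 ω) => hxy.trans_lt hω)
  have htail : ∀ i, 1 ≤ i → ∀ y, P.real {ω | y < X i ω} = F y := fun i hi y => by
    rw [hFdef, measureReal_def]
    exact congrArg ENNReal.toReal ((hXid i hi).measure_mem_eq measurableSet_Ioi)
  obtain ⟨C, x₀, hC, hx₀, hpot⟩ := exists_forall_div_le_rpow_mul hFanti
    (fun x => measureReal_le_one) hFpos hp (hα.trans hp) (hRV 2 two_pos)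
  have hRV' : ∀ i ∈ Set.Ici 1, ∀ t : ℝ, 0 < t →
      Tendsto (fun x => P.real {ω | t * x < X i ω} / F x) atTop (nhds (t ^ (-α))) := by
    intro i hi t ht
    simp only [htail i hi]
    exact hRV t ht
  have hpair : ∀ i ∈ Set.Ici 1, ∀ j ∈ Set.Ici 1, i ≠ j → ∀ t : ℝ, 0 < t →
      Tendsto (fun x => P.real {ω | t * x < X i ω ∧ t * x < X j ω} / F x) atTop (nhds 0) := by
    intro i hi j hj hij t ht
    have hlim : Tendsto (fun x => P.real {ω | x < X i ω ∧ x < X j ω} / F x) atTop (nhds 0) := by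
      refine tendsto_order.2 ⟨fun u hu => Eventually.of_forall fun x =>
        hu.trans_le (div_nonneg measureReal_nonneg (hF0 x)), fun u hu => ?_⟩
      obtain ⟨y, hy⟩ := hUAI (u / 2) (half_pos hu)
      filter_upwards [eventually_ge_atTop y, eventually_gt_atTop 0] with x hx hx0
      rw [div_lt_iff₀ (hFpos x hx0)]
      refine (hy x hx i j hi hj hij).trans_lt ?_
      exact mul_lt_mul_of_pos_right (half_lt_self hu) (hFpos x hx0)
    have hprod := (hlim.comp (tendsto_id.const_mul_atTop ht)).mul (hRV t ht)
    rw [zero_mul] at hprod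
    refine hprod.congr' ?_
    filter_upwards [eventually_gt_atTop 0] with x hx
    exact div_mul_div_cancel₀ (hFpos _ (mul_pos ht hx)).ne'
  have hkey : Tendsto (fun x => ∫ ω', P.real {ω | x < ∑ i ∈ Finset.Icc 1 (N ω'), X i ω * θ i ω'} /
      F x ∂P) atTop (nhds (∫ ω, ∑ i ∈ Finset.Icc 1 (N ω), θ i ω ^ α ∂P)) := by
    refine tendsto_integral_filter_of_dominated_convergence
      (fun ω => C * ∑ i ∈ Finset.Icc 1 (N ω), ((N ω : ℝ) * m i ω) ^ p) ?_ ?_ (hint.const_mul C) ?_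
    · exact Eventually.of_forall fun x =>
        ((measure_lt_sum_Icc_one hX hθ hN h x).1.div_const _).aestronglyMeasurable
    · filter_upwards [eventually_ge_atTop x₀] with x hx
      filter_upwards [hθm] with ω hω
      rw [Real.norm_of_nonneg (div_nonneg measureReal_nonneg (hF0 x)),
        div_le_iff₀ (hFpos x (hx₀.trans_le hx))]
      have := measureReal_lt_sum_le (P := P) hX0 hx₀ hpot (s := Finset.Icc 1 (N ω))
        (fun i hi => htail i (Finset.mem_Icc.1 hi).1) (c := fun i => θ i ω) (m := fun i => m i ω)
        hω (fun i _ => hm1 i ω) hx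
      rwa [Nat.card_Icc, Nat.add_sub_cancel] at this
    · refine Eventually.of_forall fun ω => ?_
      have := tendsto_tail_sum (P := P) hX hX0 hF0 hRV' hpair (c := fun i => θ i ω)
        (fun i => hθ0 i ω) (Finset.Icc 1 (N ω))
        (fun i hi => (Finset.mem_Icc.1 (Finset.mem_coe.1 hi)).1) 1 one_pos
      simpa only [one_mul, Real.one_rpow, mul_one] using this
  refine hkey.congr fun x => ?_
  rw [integral_div, ← (measure_lt_sum_Icc_one hX hθ hN h x).2]

/-- A randomly stopped sum of functions of an i.d. sequence `w` and of marks `S`, the sequence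
being independent of the marks and of the stopping index. -/
theorem lintegral_random_sum {w S : ℕ → Ω → ℝ} {N : Ω → ℕ} (hw : ∀ i, Measurable (w i))
    (hS : ∀ i, Measurable (S i)) (hN : Measurable N)
    (hwid : ∀ i, 1 ≤ i → IdentDistrib (w i) (w 1) P P)
    (h : IndepFun (fun ω => fun i => w i ω) (fun ω => (N ω, fun i => S i ω)) P)
    {f : ℕ → ENNReal} {g : ℝ → ℝ → ENNReal} (hg : Measurable fun z : ℝ × ℝ => g z.1 z.2) :
    ∫⁻ ω, f (N ω) * ∑ i ∈ Finset.Icc 1 (N ω), g (w i ω) (S i ω) ∂P =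
      ∫⁻ ω', f (N ω') * ∑ i ∈ Finset.Icc 1 (N ω'), ∫⁻ ω, g (w 1 ω) (S i ω') ∂P ∂P := by
  have hF : Measurable fun z : (ℕ → ℝ) × ℕ × (ℕ → ℝ) =>
      f z.2.1 * ∑ i ∈ Finset.Icc 1 z.2.1, g (z.1 i) (z.2.2 i) := by
    refine measurable_apply_nat
      (f := fun n (z : (ℕ → ℝ) × ℕ × (ℕ → ℝ)) =>
        f n * ∑ i ∈ Finset.Icc 1 n, g (z.1 i) (z.2.2 i))
      (fun n => Measurable.const_mul (Finset.measurable_sum _ fun i _ => ?_) _) (by fun_prop)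
    have hz : Measurable fun z : (ℕ → ℝ) × ℕ × (ℕ → ℝ) => (z.1 i, z.2.2 i) := by fun_prop
    exact hg.comp hz
  rw [h.lintegral_uncurry (measurable_pi_lambda _ hw) (hN.prodMk (measurable_pi_lambda _ hS))
    (F := fun a b => f b.1 * ∑ i ∈ Finset.Icc 1 b.1, g (a i) (b.2 i)) hF]
  refine lintegral_congr fun ω' => ?_
  have hgm : ∀ i, Measurable fun v => g v (S i ω') := fun i =>
    hg.comp (measurable_id.prodMk measurable_const)
  have hgw : ∀ i, Measurable fun ω => g (w i ω) (S i ω') := fun i => (hgm i).comp (hw i)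
  rw [lintegral_const_mul _ (Finset.measurable_sum _ fun i _ => hgw i),
    lintegral_finsetSum _ fun i _ => hgw i]
  congr 1
  refine Finset.sum_congr rfl fun i hi => ?_
  exact ((hwid i (Finset.mem_Icc.1 hi).1).comp (hgm i)).lintegral_eq

end

/-- Tail behaviour of the KDEM exponential shot noise with random elimination
parameter: for a homogeneous Poisson process of rate `lam` on `[0, T]` (so `N` is Poisson with
mean `lam · T` and, given `N = n`, the arrival times are the order statistics of `n` i.i.d.
uniforms on `[0, T]`), i.i.d. elimination parameters `(w i)` with Cramér condition
`E[exp(p · w₋ · T)] < ∞` for some `p > α`, and shocks `X i` identically distributed, regularly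
varying with index `α > 0` and uniformly asymptotically independent, the shot noise
`Y(T) = ∑_{i=1}^N X i · exp(−w i (T − Ta i))` satisfies
`P(Y(T) > x)/P(X 1 > x) → lam · E[(1 − exp(−α w T))/(α w)]`, the integrand being `T` at `w = 0`. -/
theorem kdem_shot_noise_tail
    {Ω : Type*} [MeasurableSpace Ω] (P : Measure Ω) [IsProbabilityMeasure P]
    (T : ℝ) (hT : 0 < T) (lam : ℝ) (hlam : 0 < lam)
    -- the shocks
    (X : ℕ → Ω → ℝ) (hXmeas : ∀ i, Measurable (X i))
    (hXnonneg : ∀ i ω, 0 ≤ X i ω)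
    (hXid : ∀ i, 1 ≤ i → IdentDistrib (X i) (X 1) P P)
    (α : ℝ) (hα : 0 < α)
    (hRVpos : ∀ x : ℝ, 0 < x → 0 < P {ω | x < X 1 ω})
    (hRV : ∀ t : ℝ, 0 < t →
      Tendsto (fun x => (P {ω | t * x < X 1 ω}).toReal / (P {ω | x < X 1 ω}).toReal)
        atTop (nhds (t ^ (-α))))
    (hUAI : ∀ ε : ℝ, 0 < ε → ∃ x₀ : ℝ, ∀ x ≥ x₀, ∀ i j : ℕ, 1 ≤ i → 1 ≤ j → i ≠ j →
      (P {ω | x < X i ω ∧ x < X j ω}).toReal ≤ ε * (P {ω | x < X 1 ω}).toReal)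
    -- the Poisson number of shocks
    (N : Ω → ℕ) (hNmeas : Measurable N)
    (hNpois : ∀ k : ℕ,
      P {ω | N ω = k} =
        ENNReal.ofReal (Real.exp (-(lam * T)) * (lam * T) ^ k / (Nat.factorial k)))
    -- i.i.d. uniform random variables on `[0, T]`
    (V : ℕ → Ω → ℝ) (hVmeas : ∀ i, Measurable (V i))
    (hViid : iIndepFun V P)
    (hVid : ∀ i, IdentDistrib (V i) (V 0) P P)
    (hVlaw : ∀ B : Set ℝ, MeasurableSet B →
      P {ω | V 0 ω ∈ B} = ∫⁻ t in B ∩ Set.Icc 0 T, ENNReal.ofReal (1 / T) ∂volume)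
    -- the arrival times: conditionally on `N = n`, distributed as the order statistics
    (Ta : ℕ → Ω → ℝ) (hTameas : ∀ i, Measurable (Ta i))
    (hOS : ∀ n : ℕ, ∀ B : Set (Fin n → ℝ), MeasurableSet B →
      P {ω | (fun i : Fin n => Ta ((i : ℕ) + 1) ω) ∈ B ∧ N ω = n} =
        P {ω | (fun i : Fin n =>
            V (((Tuple.sort (fun k : Fin n => V ((k : ℕ) + 1) ω)) i : ℕ) + 1) ω) ∈ B}
          * P {ω | N ω = n})
    -- the i.i.d. elimination parameters, satisfying the Cramér condition
    (w : ℕ → Ω → ℝ) (hwmeas : ∀ i, Measurable (w i))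
    (hwiid : iIndepFun w P)
    (hwid : ∀ i, 1 ≤ i → IdentDistrib (w i) (w 1) P P)
    (hwmom : ∃ p : ℝ, α < p ∧
      ∫⁻ ω, ENNReal.ofReal (Real.exp (p * max (-(w 1 ω)) 0 * T)) ∂P < ⊤)
    -- independence between the various ingredients
    (hw_indep : IndepFun (fun ω => fun i : ℕ => w i ω)
      (fun ω => (N ω, fun i : ℕ => Ta i ω, fun i : ℕ => X i ω)) P)
    (hX_indep : IndepFun (fun ω => fun i : ℕ => X i ω)
      (fun ω => (N ω, fun i : ℕ => Ta i ω, fun i : ℕ => w i ω, fun i : ℕ => V i ω)) P) :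
    Tendsto (fun x =>
        (P {ω | x < ∑ i ∈ Finset.Icc 1 (N ω),
            X i ω * Real.exp (-(w i ω * (T - Ta i ω)))}).toReal
          / (P {ω | x < X 1 ω}).toReal)
      atTop
      (nhds (lam * ∫ ω,
        (if w 1 ω = 0 then T
          else (1 - Real.exp (-(α * w 1 ω * T))) / (α * w 1 ω)) ∂P)) := by
  obtain ⟨p, hαp, hmom⟩ := hwmom
  have hp0 : 0 < p := hα.trans hαp
  have hr : 0 < lam * T := mul_pos hlam hT
  have hwTa : IndepFun (fun ω => fun i => w i ω) (fun ω => (N ω, fun i => Ta i ω)) P :=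
    hw_indep.comp measurable_id
      (by fun_prop : Measurable fun z : ℕ × (ℕ → ℝ) × (ℕ → ℝ) => (z.1, z.2.1))
  have hXθ : IndepFun (fun ω => fun i => X i ω)
      (fun ω => (N ω, fun i => Real.exp (-(w i ω * (T - Ta i ω))))) P :=
    hX_indep.comp measurable_id
      (by fun_prop : Measurable fun z : ℕ × (ℕ → ℝ) × (ℕ → ℝ) × (ℕ → ℝ) =>
        (z.1, fun i => Real.exp (-(z.2.2.1 i * (T - z.2.1 i)))))
  have hθ : ∀ i, Measurable fun ω => Real.exp (-(w i ω * (T - Ta i ω))) := fun i => by fun_prop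
  have hVmap : P.map (V 0) = ENNReal.ofReal (1 / T) • volume.restrict (Set.Icc 0 T) := by
    ext B hB
    rw [Measure.map_apply (hVmeas 0) hB, Measure.smul_apply, Measure.restrict_apply hB, smul_eq_mul,
      ← setLIntegral_const]
    exact hVlaw B hB
  have hTaIcc : ∀ᵐ ω ∂P, ∀ i ∈ Finset.Icc 1 (N ω), Ta i ω ∈ Set.Icc 0 T := by
    have hG : Measurable ((Set.Icc 0 T)ᶜ.indicator (1 : ℝ → ENNReal)) :=
      measurable_one.indicator measurableSet_Icc.compl
    have h0 := lintegral_sum_arrival hNmeas hVmeas hVid hTameas hOS hG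
    rw [← lintegral_map hG (hVmeas 0), hVmap, lintegral_smul_measure,
      lintegral_indicator_one measurableSet_Icc.compl, Measure.restrict_apply' measurableSet_Icc,
      Set.compl_inter_self, measure_empty, smul_zero, mul_zero, lintegral_eq_zero_iff] at h0
    · filter_upwards [h0] with ω hω i hi
      by_contra hc
      have := (Finset.sum_eq_zero_iff.1 hω) i hi
      rw [Set.indicator_of_mem hc] at this
      exact one_ne_zero this
    · exact measurable_apply_nat (f := fun n ω => ∑ i ∈ Finset.Icc 1 n, _)
        (fun n => Finset.measurable_sum _ fun i _ => hG.comp (hTameas i)) hNmeas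
  have hθm : ∀ᵐ ω ∂P, ∀ i ∈ Finset.Icc 1 (N ω),
      Real.exp (-(w i ω * (T - Ta i ω))) ≤ Real.exp (max (-(w i ω)) 0 * T) := by
    filter_upwards [hTaIcc] with ω hω i hi
    obtain ⟨h1, h2⟩ := hω i hi
    rw [Real.exp_le_exp, ← neg_mul]
    calc -w i ω * (T - Ta i ω) ≤ max (-(w i ω)) 0 * (T - Ta i ω) :=
          mul_le_mul_of_nonneg_right (le_max_left _ _) (by linarith)
      _ ≤ max (-(w i ω)) 0 * T := mul_le_mul_of_nonneg_left (by linarith) (le_max_right _ _)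
  have hint : Integrable (fun ω => ∑ i ∈ Finset.Icc 1 (N ω),
      ((N ω : ℝ) * Real.exp (max (-(w i ω)) 0 * T)) ^ p) P := by
    refine ⟨(measurable_apply_nat
      (f := fun n ω => ∑ i ∈ Finset.Icc 1 n, ((n : ℝ) * Real.exp (max (-(w i ω)) 0 * T)) ^ p)
      (fun n => Finset.measurable_sum _ fun i _ => by fun_prop) hNmeas).aestronglyMeasurable, ?_⟩
    rw [hasFiniteIntegral_iff_ofReal (Eventually.of_forall fun ω => by positivity)]
    have hg : Measurable fun z : ℝ × ℝ =>
      ENNReal.ofReal (Real.exp (p * max (-z.1) 0 * T)) := by fun_prop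
    have heq : ∀ ω, ENNReal.ofReal (∑ i ∈ Finset.Icc 1 (N ω),
        ((N ω : ℝ) * Real.exp (max (-(w i ω)) 0 * T)) ^ p) =
        ENNReal.ofReal ((N ω : ℝ) ^ p) * ∑ i ∈ Finset.Icc 1 (N ω),
          ENNReal.ofReal (Real.exp (p * max (-(w i ω)) 0 * T)) := by
      intro ω
      rw [ENNReal.ofReal_sum_of_nonneg fun i _ => by positivity, Finset.mul_sum]
      refine Finset.sum_congr rfl fun i _ => ?_
      rw [← ENNReal.ofReal_mul (by positivity), Real.mul_rpow (by positivity) (by positivity),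
        ← Real.exp_mul]
      ring_nf
    simp only [heq]
    rw [lintegral_random_sum hwmeas hTameas hNmeas hwid hwTa
      (f := fun n => ENNReal.ofReal ((n : ℝ) ^ p))
      (g := fun v _ => ENNReal.ofReal (Real.exp (p * max (-v) 0 * T))) hg]
    simp only [Finset.sum_const, Nat.card_Icc, Nat.add_sub_cancel, nsmul_eq_mul, ← mul_assoc]
    simp only [mul_assoc p] at hmom ⊢
    rw [lintegral_mul_const _ (by fun_prop)]
    exact ENNReal.mul_lt_top (lintegral_rpow_mul_poisson_lt_top hNmeas hr hNpois p) hmom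
  have hmain := tendsto_tail_random_weighted_sum hXmeas hXnonneg hθ (fun i ω => Real.exp_pos _)
    hNmeas hXid hα hαp hRVpos hRV hUAI hXθ
    (fun i ω => Real.one_le_exp (mul_nonneg (le_max_right _ _) hT.le)) hθm hint
  have hg : Measurable fun z : ℝ × ℝ =>
    ENNReal.ofReal (Real.exp (-(z.1 * (T - z.2))) ^ α) := by fun_prop
  have hgw : Measurable fun z : Ω × ℝ =>
    ENNReal.ofReal (Real.exp (-(w 1 z.1 * (T - z.2))) ^ α) := by fun_prop
  have hlim : ∫ ω, ∑ i ∈ Finset.Icc 1 (N ω), Real.exp (-(w i ω * (T - Ta i ω))) ^ α ∂P =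
      lam * ∫ ω, (if w 1 ω = 0 then T
        else (1 - Real.exp (-(α * w 1 ω * T))) / (α * w 1 ω)) ∂P := by
    have hφ : Measurable fun ω => if w 1 ω = 0 then T
        else (1 - Real.exp (-(α * w 1 ω * T))) / (α * w 1 ω) :=
      Measurable.ite (hwmeas 1 (measurableSet_singleton 0)) measurable_const (by fun_prop)
    rw [integral_eq_lintegral_of_nonneg_ae (Eventually.of_forall fun ω => by positivity)
      (measurable_apply_nat
        (f := fun n ω => ∑ i ∈ Finset.Icc 1 n, Real.exp (-(w i ω * (T - Ta i ω))) ^ α)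
        (fun n => Finset.measurable_sum _ fun i _ => by fun_prop) hNmeas).aestronglyMeasurable,
      integral_eq_lintegral_of_nonneg_ae
        (Eventually.of_forall fun ω => (lintegral_ofReal_exp_rpow hT hα (w 1 ω)).1)
        hφ.aestronglyMeasurable]
    have hsum : ∀ ω, ENNReal.ofReal (∑ i ∈ Finset.Icc 1 (N ω),
        Real.exp (-(w i ω * (T - Ta i ω))) ^ α) = 1 * ∑ i ∈ Finset.Icc 1 (N ω),
          ENNReal.ofReal (Real.exp (-(w i ω * (T - Ta i ω))) ^ α) := fun ω => by
      rw [ENNReal.ofReal_sum_of_nonneg fun i _ => by positivity, one_mul]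
    simp only [hsum]
    rw [lintegral_random_sum hwmeas hTameas hNmeas hwid hwTa (f := fun _ => 1)
      (g := fun v t => ENNReal.ofReal (Real.exp (-(v * (T - t))) ^ α)) hg]
    simp only [one_mul]
    have hGm : Measurable fun t => ∫⁻ ω, ENNReal.ofReal (Real.exp (-(w 1 ω * (T - t))) ^ α) ∂P :=
      hgw.lintegral_prod_left'
    rw [lintegral_sum_arrival hNmeas hVmeas hVid hTameas hOS hGm,
      lintegral_poisson hNmeas hr hNpois, ← lintegral_map hGm (hVmeas 0), hVmap,
      lintegral_smul_measure, smul_eq_mul, ← mul_assoc, ← ENNReal.ofReal_mul hr.le,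
      mul_assoc, mul_one_div_cancel hT.ne', mul_one, lintegral_lintegral_swap
        (f := fun t ω => ENNReal.ofReal (Real.exp (-(w 1 ω * (T - t))) ^ α))
        (hgw.comp measurable_swap).aemeasurable]
    simp only [(lintegral_ofReal_exp_rpow hT hα _).2]
    rw [ENNReal.toReal_mul, ENNReal.toReal_ofReal hlam.le]
  rw [← hlim]
  exact hmain
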